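/- Let n be a nonnegative integer and a, b, c, d, p, q ∈ ℂ. Set λ = 2a−b−c−d and w = 1+2a−2λ−n. Assume 2q − a ≠ 0 and bcd + p(a−p)(a−b−c−d) ≠ 0, set α = q(2λ−a)/(2q−a), and let γ, δ ∈ ℂ satisfy γ² = λ²/4 − p(a−p)(a−b−c)(a−b−d)(a−c−d)/(bcd + p(a−p)(a−b−c−d)) and δ² = λ²/4 − (q(2λ−a)+n(2q−a))/2. Assume the parameters are nondegenerate for the identity below. Then ₈F₇(a, b, c, d, a−p+1, p+1, q+1, −n; 1+a−b, 1+a−c, 1+a−d, p, a−p, q, w; 1) = [ (2λ−a)_n (λ−a)_n (α+1)_n / ( (1+λ)_n (2λ−2a)_n (α)_n ) ] · ₁₃F₁₂(λ, 1+λ/2, a/2, (a+1)/2, λ+b−a, λ+c−a, λ+d−a, 1+a−w, λ/2−γ+1, λ/2+γ+1, λ/2−δ+1, λ/2+δ+1, −n; λ/2, (2+2λ−a)/2, (1+2λ−a)/2, 1+a−b, 1+a−c, 1+a−d, λ+w−a, λ/2+γ, λ/2−γ, λ/2+δ, λ/2−δ, 1+λ+n; 1). -/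

import Mathlib

/-- Rising factorial (Pochhammer symbol) `(a)ₖ = a(a+1)⋯(a+k−1)`. -/
noncomputable def poch (a : ℂ) (k : ℕ) : ℂ := (ascPochhammer ℂ k).eval a

/-- Terminating hypergeometric sum with numerator parameters `A` together with
the extra top parameter `-n`, denominator parameters `B`, and argument `x`. -/
noncomputable def hypTerm (A B : List ℂ) (n : ℕ) (x : ℂ) : ℂ :=
  ∑ k ∈ Finset.range (n + 1),
    ((A.map fun a => poch a k).prod * poch (-(n : ℂ)) k) /
      ((k.factorial : ℂ) * (B.map fun b => poch b k).prod) * x ^ k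

lemma poch_zero (z : ℂ) : poch z 0 = 1 := by simp [poch]

lemma poch_succ (z : ℂ) (k : ℕ) : poch z (k + 1) = poch z k * (z + k) := by
  simp [poch, ascPochhammer_succ_eval]

lemma poch_one (k : ℕ) : poch 1 k = k.factorial := by
  simp [poch, ascPochhammer_eval_one]

lemma poch_add (z : ℂ) (m k : ℕ) : poch z (m + k) = poch z m * poch (z + m) k := by
  induction k with
  | zero => simp [poch_zero]
  | succ k ih => rw [← add_assoc, poch_succ, ih, poch_succ]; push_cast; ring

lemma poch_succ_left (z : ℂ) (k : ℕ) : poch z (k + 1) = z * poch (z + 1) k := by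
  rw [add_comm, poch_add, poch_succ, poch_zero]; simp

lemma poch_add_one_mul (z : ℂ) (k : ℕ) : poch (z + 1) k * z = poch z k * (z + k) := by
  rw [← poch_succ, poch_succ_left, mul_comm]

lemma poch_ne_zero_iff {z : ℂ} {n : ℕ} : poch z n ≠ 0 ↔ ∀ k < n, z + k ≠ 0 := by
  induction n with
  | zero => simp [poch_zero]
  | succ n ih => rw [poch_succ, mul_ne_zero_iff, ih]; grind

lemma poch_ne_zero_of_le {z : ℂ} {m n : ℕ} (h : poch z n ≠ 0) (hmn : m ≤ n) : poch z m ≠ 0 :=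
  poch_ne_zero_iff.2 fun k hk => poch_ne_zero_iff.1 h k (hk.trans_le hmn)

lemma poch_neg_reflect (z : ℂ) (k : ℕ) : poch (1 - z - k) k = (-1) ^ k * poch z k := by
  induction k with
  | zero => simp [poch_zero]
  | succ k ih =>
    rw [poch_succ_left, poch_succ, pow_succ, show 1 - z - ((k + 1 : ℕ) : ℂ) + 1 = 1 - z - k by
      push_cast; ring, ih]
    push_cast
    ring

lemma poch_reverse (z : ℂ) {n k : ℕ} (hk : k ≤ n) :
    poch (1 - z - n) k * poch z (n - k) = (-1) ^ k * poch z n := by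
  obtain ⟨m, rfl⟩ := Nat.exists_eq_add_of_le' hk
  rw [Nat.add_sub_cancel, poch_add, show 1 - z - ((m + k : ℕ) : ℂ) = 1 - (z + m) - k by
    push_cast; ring, poch_neg_reflect]
  ring

lemma poch_two_mul (z : ℂ) (r : ℕ) :
    poch z (2 * r) = 4 ^ r * (poch (z / 2) r * poch ((z + 1) / 2) r) := by
  induction r with
  | zero => simp [poch_zero]
  | succ r ih =>
    rw [show 2 * (r + 1) = 2 * r + 1 + 1 by ring, poch_succ, poch_succ, ih, poch_succ, poch_succ]
    push_cast
    ring

/-- The Pfaff–Saalschütz summation, written as a convolution. -/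
lemma sum_saalschutz (A B C : ℂ) (m : ℕ) (hC : poch C m ≠ 0) :
    ∑ j ∈ Finset.range (m + 1), poch A j * poch B j * poch (C - A - B) (m - j) /
        (j.factorial * (m - j).factorial * poch C j) =
      poch (C - A) m * poch (C - B) m / (m.factorial * poch C m) := by
  induction m with
  | zero => simp [poch_zero]
  | succ m ih =>
    have hCm := poch_ne_zero_of_le hC m.le_succ
    have hm : C + m ≠ 0 := poch_ne_zero_iff.1 hC m m.lt_succ_self
    have hm1 : (m : ℂ) + 1 ≠ 0 := Nat.cast_add_one_ne_zero m
    have key : ∀ R ≤ m + 1,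
        ∑ j ∈ Finset.range R,
          ((m + 1) * (C + m) * (poch A j * poch B j * poch (C - A - B) (m + 1 - j) /
              (j.factorial * (m + 1 - j).factorial * poch C j)) -
            (C - A + m) * (C - B + m) * (poch A j * poch B j * poch (C - A - B) (m - j) /
              (j.factorial * (m - j).factorial * poch C j))) =
          -(R * (C + R - 1) * (poch A R * poch B R * poch (C - A - B) (m + 1 - R) /
              (R.factorial * (m + 1 - R).factorial * poch C R))) := by
      intro R
      induction R with
      | zero => simp
      | succ j ihj =>
        intro hj
        obtain ⟨s, rfl⟩ := Nat.exists_eq_add_of_le (Nat.le_of_succ_le_succ hj)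
        rw [Finset.sum_range_succ, ihj (by omega), show j + s + 1 - j = s + 1 by omega,
          show j + s - j = s by omega, show j + s + 1 - (j + 1) = s by omega]
        have h1 := poch_ne_zero_of_le hC (show j ≤ j + s + 1 by omega)
        have h2 := poch_ne_zero_iff.1 hC j (by omega)
        have h3 : (j : ℂ) + 1 ≠ 0 := Nat.cast_add_one_ne_zero j
        have h4 : (s : ℂ) + 1 ≠ 0 := Nat.cast_add_one_ne_zero s
        simp only [poch_succ, Nat.factorial_succ]
        push_cast
        field_simp
        ring
    have hk := key (m + 1) le_rfl
    rw [Finset.sum_sub_distrib, ← Finset.mul_sum, ← Finset.mul_sum, ih hCm] at hk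
    rw [Finset.sum_range_succ]
    have h5 : ((m : ℂ) + 1) * (C + m) ≠ 0 := mul_ne_zero hm1 hm
    apply mul_left_cancel₀ h5
    rw [mul_add, eq_add_of_sub_eq hk]
    simp only [poch_succ, Nat.factorial_succ]
    push_cast
    field_simp
    ring

/-- The terms, up to the factor `l + 2 * r`, common to well-poised series based at `l`. -/
noncomputable def wellPoisedTerm (l B C D : ℂ) (r : ℕ) : ℂ :=
  poch l r * (poch B r * poch C r * poch D r) /
    (r.factorial * (poch (1 + l - B) r * poch (1 + l - C) r * poch (1 + l - D) r))

/-- The kernel of the Bailey transform, in terms of the difference `s` of its two indices. -/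
noncomputable def baileyKernel (e l : ℂ) (r s : ℕ) : ℂ :=
  poch e (2 * r + s) * poch (e - l) s / (s.factorial * poch (1 + l) (2 * r + s))

lemma wellPoisedTerm_succ (l B C D : ℂ) (r : ℕ) :
    wellPoisedTerm l B C D (r + 1) = wellPoisedTerm l B C D r *
      ((l + r) * (B + r) * (C + r) * (D + r) /
        ((r + 1) * (1 + l - B + r) * (1 + l - C + r) * (1 + l - D + r))) := by
  rw [wellPoisedTerm, wellPoisedTerm, div_mul_div_comm]
  simp only [poch_succ, Nat.factorial_succ]
  push_cast
  congr 1 <;> ring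

lemma baileyKernel_succ (e l : ℂ) (r s : ℕ) :
    baileyKernel e l r (s + 1) = baileyKernel e l r s *
      ((e + 2 * r + s) * (e - l + s) / ((s + 1) * (1 + l + 2 * r + s))) := by
  rw [baileyKernel, baileyKernel, div_mul_div_comm]
  simp only [← add_assoc, poch_succ, Nat.factorial_succ]
  push_cast
  congr 1 <;> ring

/-- The polynomial identity behind the telescoping proof of Dougall's summation. -/
lemma dougall_telescoping_identity (l B C D e r s : ℂ) (he : e = 1 + 2 * l - B - C - D) :
    (l + 2 * r) * ((r + s + 1) * (1 + l - B + (r + s)) * (1 + l - C + (r + s)) *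
        (1 + l - D + (r + s)) * ((e + 2 * r + s) * (e - l + s)) -
      (e + (r + s)) * (1 + l - B - C + (r + s)) * (1 + l - B - D + (r + s)) *
        (1 + l - C - D + (r + s)) * ((s + 1) * (1 + l + 2 * r + s))) =
    -(e + 2 * (r + s) + 1) * ((l + r) * (B + r) * (C + r) * (D + r) * (e + 2 * r + s) * (s + 1) -
      r * (l - B + r) * (l - C + r) * (l - D + r) * (e - l + s) * (1 + l + 2 * r + s)) := by
  subst he
  ring

lemma wellPoisedTerm_succ_mul {l B C D : ℂ} {r : ℕ} (hB : 1 + l - B + r ≠ 0)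
    (hC : 1 + l - C + r ≠ 0) (hD : 1 + l - D + r ≠ 0) :
    wellPoisedTerm l B C D (r + 1) *
        ((r + 1) * (1 + l - B + r) * (1 + l - C + r) * (1 + l - D + r)) =
      wellPoisedTerm l B C D r * ((l + r) * (B + r) * (C + r) * (D + r)) := by
  have hr : (r : ℂ) + 1 ≠ 0 := Nat.cast_add_one_ne_zero r
  rw [wellPoisedTerm_succ, mul_assoc, div_mul_cancel₀]
  exact mul_ne_zero (mul_ne_zero (mul_ne_zero hr hB) hC) hD

lemma baileyKernel_mul_succ_left (e l : ℂ) (r s : ℕ) :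
    poch e (2 * r + s + 1) * poch (e - l) s / (s.factorial * poch (1 + l) (2 * r + s + 1)) =
      baileyKernel e l r s * ((e + 2 * r + s) / (1 + l + 2 * r + s)) := by
  rw [baileyKernel, div_mul_div_comm]
  simp only [poch_succ]
  push_cast
  congr 1 <;> ring

lemma baileyKernel_mul_succ_right (e l : ℂ) (r s : ℕ) :
    poch e (2 * r + s) * poch (e - l) (s + 1) /
        ((s + 1).factorial * poch (1 + l) (2 * r + s)) =
      baileyKernel e l r s * ((e - l + s) / (s + 1)) := by
  rw [baileyKernel, div_mul_div_comm]
  simp only [poch_succ, Nat.factorial_succ]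
  push_cast
  congr 1 <;> ring

lemma mul_baileyKernel_zero (e : ℂ) {l : ℂ} {N : ℕ} (h : 1 + l + (N + (N + 1) : ℕ) ≠ 0) :
    (l + 2 * (N + 1 : ℕ)) * baileyKernel e l (N + 1) 0 =
      (e + 2 * N + 1) * (poch e (N + (N + 1)) * poch (e - l) 0 /
        (Nat.factorial 0 * poch (1 + l) (N + (N + 1)))) := by
  rw [baileyKernel, show 2 * (N + 1) + 0 = N + (N + 1) + 1 by ring, poch_succ, poch_succ,
    show l + 2 * ((N + 1 : ℕ) : ℂ) = 1 + l + (N + (N + 1) : ℕ) by push_cast; ring,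
    show e + 2 * N + 1 = e + (N + (N + 1) : ℕ) by push_cast; ring]
  rw [← mul_div_assoc, ← mul_div_assoc,
    ← mul_div_mul_left _ (Nat.factorial 0 * poch (1 + l) (N + (N + 1))) h]
  congr 1 <;> ring

lemma telescoping_step {x y W L K n u v k Z p Y m : ℂ} (hu : u ≠ 0) (hv : v ≠ 0)
    (h : L * (x * n - y * (u * v)) = k * (Z * p * u - Y * m * v)) :
    k * (W * Y * (K * (m / u))) + (x * (W * L * (K * (n / (u * v)))) - y * (W * L * K)) =
      k * (W * Z * (K * (p / v))) := by
  field_simp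
  linear_combination W * K * h

lemma dougall_ratio {E a b c l p q₁ q₂ q₃ f r₁ r₂ r₃ n x₁ x₂ x₃ : ℂ} (hn : n ≠ 0) (h₁ : x₁ ≠ 0)
    (h₂ : x₂ ≠ 0) (h₃ : x₃ ≠ 0) :
    E * a * b * c * (l * (p * (q₁ * q₂ * q₃) / (f * (r₁ * r₂ * r₃)))) =
      n * x₁ * x₂ * x₃ * (l * (p * E * (q₁ * a * (q₂ * b) * (q₃ * c)) /
        (n * f * (r₁ * x₁ * (r₂ * x₂) * (r₃ * x₃))))) := by
  rw [show n * f * (r₁ * x₁ * (r₂ * x₂) * (r₃ * x₃)) =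
      (n * x₁ * x₂ * x₃) * (f * (r₁ * r₂ * r₃)) by ring, mul_left_comm _ l, mul_left_comm _ l]
  congr 1
  rw [← mul_div_assoc, ← mul_div_assoc, mul_div_mul_left _ _
    (mul_ne_zero (mul_ne_zero (mul_ne_zero hn h₁) h₂) h₃)]
  congr 1
  ring

/-- Dougall's terminating summation of the two-balanced very-well-poised series. -/
lemma sum_dougall (l B C D e : ℂ) (he : e = 1 + 2 * l - B - C - D) (N : ℕ)
    (hB : poch (1 + l - B) N ≠ 0) (hC : poch (1 + l - C) N ≠ 0) (hD : poch (1 + l - D) N ≠ 0)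
    (hl : poch (1 + l) (2 * N) ≠ 0) :
    ∑ r ∈ Finset.range (N + 1),
        wellPoisedTerm l B C D r * (l + 2 * r) * baileyKernel e l r (N - r) =
      l * (poch e N * (poch (1 + l - B - C) N * poch (1 + l - B - D) N * poch (1 + l - C - D) N) /
        (N.factorial * (poch (1 + l - B) N * poch (1 + l - C) N * poch (1 + l - D) N))) := by
  induction N with
  | zero => simp [poch_zero, wellPoisedTerm, baileyKernel]
  | succ N ih =>
    have hB0 := poch_ne_zero_of_le hB N.le_succ
    have hC0 := poch_ne_zero_of_le hC N.le_succ
    have hD0 := poch_ne_zero_of_le hD N.le_succ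
    have hBN := poch_ne_zero_iff.1 hB N N.lt_succ_self
    have hCN := poch_ne_zero_iff.1 hC N N.lt_succ_self
    have hDN := poch_ne_zero_iff.1 hD N N.lt_succ_self
    have hN1 : (N : ℂ) + 1 ≠ 0 := Nat.cast_add_one_ne_zero N
    have key : ∀ R ≤ N + 1,
        ∑ r ∈ Finset.range R,
          ((N + 1) * (1 + l - B + N) * (1 + l - C + N) * (1 + l - D + N) *
              (wellPoisedTerm l B C D r * (l + 2 * r) * baileyKernel e l r (N + 1 - r)) -
            (e + N) * (1 + l - B - C + N) * (1 + l - B - D + N) * (1 + l - C - D + N) *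
              (wellPoisedTerm l B C D r * (l + 2 * r) * baileyKernel e l r (N - r))) =
          -(e + 2 * N + 1) * (wellPoisedTerm l B C D R *
            (R * (l - B + R) * (l - C + R) * (l - D + R)) *
            (poch e (N + R) * poch (e - l) (N + 1 - R) /
              ((N + 1 - R).factorial * poch (1 + l) (N + R)))) := by
      intro R
      induction R with
      | zero => simp
      | succ r ihr =>
        intro hr
        obtain ⟨s, rfl⟩ := Nat.exists_eq_add_of_le (Nat.le_of_succ_le_succ hr)
        rw [Finset.sum_range_succ, ihr (by omega), show r + s + 1 - r = s + 1 by omega,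
          show r + s - r = s by omega, show r + s + 1 - (r + 1) = s by omega,
          show r + s + (r + 1) = 2 * r + s + 1 by ring, show r + s + r = 2 * r + s by ring,
          baileyKernel_mul_succ_left, baileyKernel_mul_succ_right, baileyKernel_succ]
        have h2 := poch_ne_zero_iff.1 hB r (by omega)
        have h4 := poch_ne_zero_iff.1 hC r (by omega)
        have h6 := poch_ne_zero_iff.1 hD r (by omega)
        have h8 := poch_ne_zero_iff.1 hl (2 * r + s) (by omega)
        have h10 : (s : ℂ) + 1 ≠ 0 := Nat.cast_add_one_ne_zero s
        rw [show wellPoisedTerm l B C D (r + 1) * (((r + 1 : ℕ) : ℂ) * (l - B + (r + 1 : ℕ)) *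
            (l - C + (r + 1 : ℕ)) * (l - D + (r + 1 : ℕ))) =
            wellPoisedTerm l B C D r * ((l + r) * (B + r) * (C + r) * (D + r)) by
          rw [← wellPoisedTerm_succ_mul h2 h4 h6]; push_cast; ring]
        push_cast at h8 ⊢
        rw [← add_assoc] at h8
        exact telescoping_step h10 h8 (dougall_telescoping_identity l B C D e r s he)
    have hk := key (N + 1) le_rfl
    rw [Finset.sum_sub_distrib, ← Finset.mul_sum, ← Finset.mul_sum,
      ih hB0 hC0 hD0 (poch_ne_zero_of_le hl (by omega))] at hk
    rw [Finset.sum_range_succ]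
    apply mul_left_cancel₀ (mul_ne_zero (mul_ne_zero (mul_ne_zero hN1 hBN) hCN) hDN)
    have h2 := poch_ne_zero_iff.1 hl (N + (N + 1)) (by omega)
    have hlast : -(e + 2 * N + 1) * (wellPoisedTerm l B C D (N + 1) *
          (((N + 1 : ℕ) : ℂ) * (l - B + (N + 1 : ℕ)) * (l - C + (N + 1 : ℕ)) *
            (l - D + (N + 1 : ℕ))) *
          (poch e (N + (N + 1)) * poch (e - l) (N + 1 - (N + 1)) /
            ((N + 1 - (N + 1)).factorial * poch (1 + l) (N + (N + 1))))) +
        (N + 1) * (1 + l - B + N) * (1 + l - C + N) * (1 + l - D + N) *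
          (wellPoisedTerm l B C D (N + 1) * (l + 2 * (N + 1 : ℕ)) *
            baileyKernel e l (N + 1) (N + 1 - (N + 1))) = 0 := by
      rw [mul_assoc (wellPoisedTerm l B C D (N + 1)) (l + 2 * (N + 1 : ℕ)), Nat.sub_self,
        mul_baileyKernel_zero e h2]
      push_cast
      ring
    rw [mul_add, eq_add_of_sub_eq hk, add_right_comm, hlast, zero_add]
    simp only [poch_succ, Nat.factorial_succ]
    push_cast
    exact dougall_ratio hN1 hBN hCN hDN

/-- A well-poised Saalschütz-type sum with one extra linear factor `Q + j`. -/
lemma sum_saalschutz_linear (A B Q : ℂ) (m : ℕ) (hC : poch (1 + A - B) m ≠ 0) (hAB : A - B ≠ 0) :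
    (A - 2 * B) * ∑ j ∈ Finset.range (m + 1),
        poch A j * poch B j * poch (-2 * B) (m - j) /
          (j.factorial * (m - j).factorial * poch (1 + A - B) j) * (Q + j) =
      poch (-B) m * poch (A - 2 * B) m / (m.factorial * poch (1 + A - B) m) *
        (Q * (A - 2 * B + 2 * m) - A * m) := by
  have hC' : poch (A - B) (m + 1) ≠ 0 := by
    rw [poch_succ_left, show A - B + 1 = 1 + A - B by ring]
    exact mul_ne_zero hAB hC
  have hS := sum_saalschutz A B (A - B) m (poch_ne_zero_of_le hC' m.le_succ)
  have hshift (j : ℕ) : poch (1 + A - B) j * (A - B) = poch (A - B) j * (A - B + j) := by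
    rw [← poch_add_one_mul, show A - B + 1 = 1 + A - B by ring]
  have h₁ : ∑ j ∈ Finset.range (m + 1),
        poch A j * poch B j * poch (-2 * B) (m - j) /
          (j.factorial * (m - j).factorial * poch (1 + A - B) j) * (A - B + j) =
      poch (-B) m * poch (A - 2 * B) m / (m.factorial * poch (1 + A - B) m) * (A - B + m) := by
    have conv {x y : ℂ} {j : ℕ} (hj : j ≤ m) : x / (y * poch (1 + A - B) j) * (A - B + j) =
        (A - B) * (x / (y * poch (A - B) j)) := by
      have h1 := poch_ne_zero_of_le hC' (show j ≤ m + 1 by omega)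
      have h2 := poch_ne_zero_of_le hC hj
      rcases eq_or_ne y 0 with rfl | hy
      · simp
      field_simp
      linear_combination -x * hshift j
    rw [conv le_rfl, show A - 2 * B = A - B - B by ring, show -B = A - B - A by ring, ← hS,
      Finset.mul_sum]
    refine Finset.sum_congr rfl fun j hj => ?_
    rw [conv (Finset.mem_range_succ_iff.1 hj), show A - B - A - B = -2 * B by ring]
  have h₂ : (A - 2 * B) * ∑ j ∈ Finset.range (m + 1),
        poch A j * poch B j * poch (-2 * B) (m - j) /
          (j.factorial * (m - j).factorial * poch (1 + A - B) j) * j =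
      poch (-B) m * poch (A - 2 * B) m / (m.factorial * poch (1 + A - B) m) * (-A * m) := by
    rcases m with _ | m
    · simp
    have h1 : 1 + A - B ≠ 0 := by simpa using poch_ne_zero_iff.1 hC 0 m.succ_pos
    have h2 : poch (2 + A - B) m ≠ 0 := by
      rw [poch_succ_left, show 1 + A - B + 1 = 2 + A - B by ring] at hC
      exact right_ne_zero_of_mul hC
    have hT := sum_saalschutz (A + 1) (B + 1) (2 + A - B) m h2
    have hm : (m.factorial : ℂ) ≠ 0 := Nat.cast_ne_zero.2 m.factorial_ne_zero
    have hm1 : (m : ℂ) + 1 ≠ 0 := Nat.cast_add_one_ne_zero m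
    rw [Finset.sum_range_succ']
    have : ∑ j ∈ Finset.range (m + 1),
        poch A (j + 1) * poch B (j + 1) * poch (-2 * B) (m + 1 - (j + 1)) /
          ((j + 1).factorial * (m + 1 - (j + 1)).factorial * poch (1 + A - B) (j + 1)) *
          (j + 1 : ℕ) = A * B / (1 + A - B) *
        (poch (1 - B) m * poch (1 + A - 2 * B) m / (m.factorial * poch (2 + A - B) m)) := by
      rw [show 1 - B = 2 + A - B - (A + 1) by ring,
        show 1 + A - 2 * B = 2 + A - B - (B + 1) by ring, ← hT, Finset.mul_sum]
      refine Finset.sum_congr rfl fun j hj => ?_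
      have hj := Finset.mem_range_succ_iff.1 hj
      have h3 := poch_ne_zero_of_le h2 hj
      have h4 : (j : ℂ) + 1 ≠ 0 := Nat.cast_add_one_ne_zero j
      have h5 : (j.factorial : ℂ) ≠ 0 := Nat.cast_ne_zero.2 j.factorial_ne_zero
      have h6 : ((m - j).factorial : ℂ) ≠ 0 := Nat.cast_ne_zero.2 (Nat.factorial_ne_zero _)
      rw [Nat.add_sub_add_right, poch_succ_left A, poch_succ_left B, poch_succ_left (1 + A - B),
        show 1 + A - B + 1 = 2 + A - B by ring, Nat.factorial_succ,
        show 2 + A - B - (A + 1) - (B + 1) = -2 * B by ring]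
      push_cast
      field_simp
    rw [this, poch_succ_left (-B), poch_succ_left (A - 2 * B), poch_succ_left (1 + A - B),
      show 1 + A - B + 1 = 2 + A - B by ring, show -B + 1 = 1 - B by ring,
      show A - 2 * B + 1 = 1 + A - 2 * B by ring, Nat.factorial_succ]
    push_cast
    field_simp
    ring
  simp only [mul_add, Finset.sum_add_distrib, ← Finset.sum_mul] at h₁ h₂ ⊢
  apply mul_left_cancel₀ hAB
  linear_combination Q * (A - 2 * B) * h₁ + (A - B - Q) * h₂

lemma poch_add_two (z : ℂ) (k : ℕ) : poch z (k + 2) = z * (1 + z) * poch (2 + z) k := by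
  rw [poch_succ_left, poch_succ_left, mul_assoc, add_comm z 1, add_right_comm 1 z 1,
    one_add_one_eq_two]

lemma wellPoisedTerm_shift (l B C D : ℂ) (r : ℕ) :
    wellPoisedTerm l B C D (r + 1) * ((r + 1) * (r + 1 + l)) =
      l * (1 + l) * (B * C * D) / ((1 + l - B) * (1 + l - C) * (1 + l - D)) *
        wellPoisedTerm (2 + l) (B + 1) (C + 1) (D + 1) r := by
  have hr : (r : ℂ) + 1 ≠ 0 := Nat.cast_add_one_ne_zero r
  have h := poch_add_two l r
  have hz (z : ℂ) : 1 + (2 + l) - (z + 1) = 1 + l - z + 1 := by ring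
  rw [poch_succ] at h
  rw [wellPoisedTerm, wellPoisedTerm, div_mul_div_comm, hz, hz, hz, poch_succ_left B,
    poch_succ_left C, poch_succ_left D, poch_succ_left (1 + l - B), poch_succ_left (1 + l - C),
    poch_succ_left (1 + l - D), Nat.factorial_succ, div_mul_eq_mul_div,
    ← mul_div_mul_left _ ((1 + l - B) * (1 + l - C) * (1 + l - D) * _) hr]
  push_cast at h ⊢
  congr 1
  · linear_combination (B * C * D * poch (B + 1) r * poch (C + 1) r * poch (D + 1) r * (r + 1)) * h
  · ring

lemma baileyKernel_shift (e l : ℂ) (r s : ℕ) :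
    baileyKernel e l (r + 1) s =
      e * (1 + e) / ((1 + l) * (2 + l)) * baileyKernel (2 + e) (2 + l) r s := by
  have h (z : ℂ) : poch z (2 * (r + 1) + s) = z * (1 + z) * poch (2 + z) (2 * r + s) := by
    rw [← poch_add_two]; congr 1; ring
  rw [baileyKernel, baileyKernel, h, h, div_mul_div_comm, add_sub_add_left_eq_sub,
    show 1 + (1 + l) = 2 + l by ring, show 2 + (1 + l) = 1 + (2 + l) by ring]
  congr 1 <;> ring

lemma sum_wellPoised_lowered (a b c d l : ℂ) (hl : l = 2 * a - b - c - d) (M : ℕ)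
    (hb : poch (1 + a - b) (M + 1) ≠ 0) (hc : poch (1 + a - c) (M + 1) ≠ 0)
    (hd : poch (1 + a - d) (M + 1) ≠ 0) (hlk : poch (1 + l) (2 * (M + 1)) ≠ 0) :
    ∑ r ∈ Finset.range (M + 1 + 1),
      wellPoisedTerm l (l + b - a) (l + c - a) (l + d - a) r * (l + 2 * r) *
        baileyKernel a l r (M + 1 - r) * ((M + 1 - r) * (1 + l + M + r)) =
      a * (a - l) * (l * (poch (a + 1) M * (poch (1 + b) M * poch (1 + c) M * poch (1 + d) M) /
        (M.factorial * (poch (1 + a - b) M * poch (1 + a - c) M * poch (1 + a - d) M)))) := by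
  have hba : 1 + l - (l + b - a) = 1 + a - b := by ring
  have hca : 1 + l - (l + c - a) = 1 + a - c := by ring
  have hda : 1 + l - (l + d - a) = 1 + a - d := by ring
  have hD := sum_dougall l (l + b - a) (l + c - a) (l + d - a) (a + 1) (by rw [hl]; ring) M
    (hba ▸ poch_ne_zero_of_le hb M.le_succ) (hca ▸ poch_ne_zero_of_le hc M.le_succ)
    (hda ▸ poch_ne_zero_of_le hd M.le_succ) (poch_ne_zero_of_le hlk (by omega))
  rw [hba, hca, hda, show 1 + a - b - (l + c - a) = 1 + d by rw [hl]; ring,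
    show 1 + a - b - (l + d - a) = 1 + c by rw [hl]; ring,
    show 1 + a - c - (l + d - a) = 1 + b by rw [hl]; ring] at hD
  rw [Finset.sum_range_succ]
  push_cast
  rw [sub_self, zero_mul, mul_zero, add_zero,
    show poch (1 + b) M * poch (1 + c) M * poch (1 + d) M =
      poch (1 + d) M * poch (1 + c) M * poch (1 + b) M by ring, ← hD, Finset.mul_sum]
  refine Finset.sum_congr rfl fun r hr => ?_
  obtain ⟨s, rfl⟩ := Nat.exists_eq_add_of_le (Finset.mem_range_succ_iff.1 hr)
  have h1 := poch_ne_zero_of_le hlk (show 2 * r + s ≤ 2 * (r + s + 1) by omega)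
  have h2 := poch_ne_zero_iff.1 hlk (2 * r + s) (by omega)
  have h3 : (s : ℂ) + 1 ≠ 0 := Nat.cast_add_one_ne_zero s
  have h4 : (s.factorial : ℂ) ≠ 0 := Nat.cast_ne_zero.2 s.factorial_ne_zero
  rw [show r + s + 1 - r = s + 1 by omega, show r + s - r = s by omega, baileyKernel,
    baileyKernel, ← add_assoc, poch_succ_left a, poch_succ_left (a - l), poch_succ,
    show a - l + 1 = a + 1 - l by ring, Nat.factorial_succ]
  push_cast at h2 ⊢
  field_simp
  ring

lemma sum_wellPoised_shifted (a b c d l : ℂ) (hl : l = 2 * a - b - c - d) (M : ℕ)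
    (hb : poch (1 + a - b) (M + 1) ≠ 0) (hc : poch (1 + a - c) (M + 1) ≠ 0)
    (hd : poch (1 + a - d) (M + 1) ≠ 0) (hlk : poch (1 + l) (2 * (M + 1)) ≠ 0) :
    ∑ r ∈ Finset.range (M + 1 + 1),
      wellPoisedTerm l (l + b - a) (l + c - a) (l + d - a) r * (l + 2 * r) *
        baileyKernel a l r (M + 1 - r) * (r * (r + l)) =
      l * ((a - b - c) * (a - b - d) * (a - c - d)) * (a * (a + 1)) *
        (poch (a + 2) M * (poch (1 + b) M * poch (1 + c) M * poch (1 + d) M) /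
        (M.factorial * (poch (1 + a - b) (M + 1) * poch (1 + a - c) (M + 1) *
          poch (1 + a - d) (M + 1)))) := by
  have hl1 : 1 + l ≠ 0 := by simpa using poch_ne_zero_iff.1 hlk 0 (by omega)
  have hl2 : 2 + l ≠ 0 := by
    have := poch_ne_zero_iff.1 hlk 1 (by omega)
    push_cast at this
    rwa [show 1 + l + 1 = 2 + l by ring] at this
  have split {z : ℂ} (h : poch (1 + z) (M + 1) ≠ 0) :
      1 + z ≠ 0 ∧ poch (2 + z) M ≠ 0 := by
    rwa [poch_succ_left, mul_ne_zero_iff, show 1 + z + 1 = 2 + z by ring] at h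
  obtain ⟨hb1, hb2⟩ := split (add_sub_assoc 1 a b ▸ hb)
  obtain ⟨hc1, hc2⟩ := split (add_sub_assoc 1 a c ▸ hc)
  obtain ⟨hd1, hd2⟩ := split (add_sub_assoc 1 a d ▸ hd)
  have hba : 1 + l - (l + b - a) = 1 + a - b := by ring
  have hca : 1 + l - (l + c - a) = 1 + a - c := by ring
  have hda : 1 + l - (l + d - a) = 1 + a - d := by ring
  have hD := sum_dougall (2 + l) (l + b - a + 1) (l + c - a + 1) (l + d - a + 1) (a + 2)
    (by rw [hl]; ring) M
    (by rw [show 1 + (2 + l) - (l + b - a + 1) = 2 + (a - b) by ring]; exact hb2)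
    (by rw [show 1 + (2 + l) - (l + c - a + 1) = 2 + (a - c) by ring]; exact hc2)
    (by rw [show 1 + (2 + l) - (l + d - a + 1) = 2 + (a - d) by ring]; exact hd2)
    (by rw [show 1 + (2 + l) = 1 + l + (2 : ℕ) by push_cast; ring]
        rw [show 2 * (M + 1) = 2 + 2 * M by ring, poch_add] at hlk
        exact right_ne_zero_of_mul hlk)
  rw [show 1 + (2 + l) - (l + b - a + 1) = 2 + (a - b) by ring,
    show 1 + (2 + l) - (l + c - a + 1) = 2 + (a - c) by ring,
    show 1 + (2 + l) - (l + d - a + 1) = 2 + (a - d) by ring,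
    show 2 + (a - b) - (l + c - a + 1) = 1 + d by rw [hl]; ring,
    show 2 + (a - b) - (l + d - a + 1) = 1 + c by rw [hl]; ring,
    show 2 + (a - c) - (l + d - a + 1) = 1 + b by rw [hl]; ring] at hD
  rw [Finset.sum_range_succ', Nat.cast_zero, zero_mul, mul_zero, add_zero]
  trans l * ((a - b - c) * (a - b - d) * (a - c - d)) * (a * (a + 1)) /
    ((2 + l) * ((1 + (a - b)) * (1 + (a - c)) * (1 + (a - d)))) *
    ((2 + l) * (poch (a + 2) M * (poch (1 + d) M * poch (1 + c) M * poch (1 + b) M) /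
      (M.factorial * (poch (2 + (a - b)) M * poch (2 + (a - c)) M * poch (2 + (a - d)) M))))
  · rw [← hD, Finset.mul_sum]
    refine Finset.sum_congr rfl fun r hr => ?_
    have hr := Finset.mem_range_succ_iff.1 hr
    have hw := wellPoisedTerm_shift l (l + b - a) (l + c - a) (l + d - a) r
    rw [hba, hca, hda, add_sub_assoc 1 a b, add_sub_assoc 1 a c, add_sub_assoc 1 a d,
      show (l + b - a) * (l + c - a) * (l + d - a) =
        (a - b - c) * (a - b - d) * (a - c - d) by rw [hl]; ring] at hw
    rw [Nat.add_sub_add_right, baileyKernel_shift, add_comm 2 a]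
    push_cast
    rw [show ∀ x y z w : ℂ, x * y * z * w = x * w * y * z by intros; ring, hw]
    generalize wellPoisedTerm _ _ _ _ r = W
    generalize baileyKernel _ _ r _ = K
    field_simp
    ring
  · rw [add_sub_assoc 1 a b, add_sub_assoc 1 a c, add_sub_assoc 1 a d, poch_succ_left (1 + _),
      poch_succ_left (1 + _), poch_succ_left (1 + _), add_right_comm 1 _ 1,
      add_right_comm 1 _ 1, add_right_comm 1 _ 1, one_add_one_eq_two,
      mul_mul_mul_comm (1 + (a - b)), mul_mul_mul_comm ((1 + (a - b)) * _),
      show poch (1 + b) M * poch (1 + c) M * poch (1 + d) M =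
        poch (1 + d) M * poch (1 + c) M * poch (1 + b) M by ring]
    generalize l * ((a - b - c) * (a - b - d) * (a - c - d)) * (a * (a + 1)) = Y
    generalize poch (1 + d) M * poch (1 + c) M * poch (1 + b) M = Q
    rw [div_mul_eq_mul_div, mul_left_comm, mul_div_mul_left _ _ hl2, mul_div_assoc, div_div]
    congr 2
    ring

/-- Pairing the Bailey kernel with a very-well-poised series that fails to be two-balanced by one,
corrected by a quadratic factor. -/
lemma sum_wellPoised_quadratic (a b c d l P : ℂ) (hl : l = 2 * a - b - c - d) (k : ℕ)
    (hb : poch (1 + a - b) k ≠ 0) (hc : poch (1 + a - c) k ≠ 0) (hd : poch (1 + a - d) k ≠ 0)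
    (hlk : poch (1 + l) (2 * k) ≠ 0) :
    ∑ r ∈ Finset.range (k + 1),
        wellPoisedTerm l (l + b - a) (l + c - a) (l + d - a) r * (l + 2 * r) *
          baileyKernel a l r (k - r) *
          ((b * c * d + P * (a - b - c - d)) * (r * (r + l)) +
            P * ((a - b - c) * (a - b - d) * (a - c - d))) =
      l * ((a - b - c) * (a - b - d) * (a - c - d)) *
        (poch a k * (poch b k * poch c k * poch d k) /
          (k.factorial * (poch (1 + a - b) k * poch (1 + a - c) k * poch (1 + a - d) k)) *
          (k ^ 2 + a * k + P)) := by
  rcases k with _ | M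
  · simp [poch_zero, wellPoisedTerm, baileyKernel]; ring
  have hM1 : (M : ℂ) + 1 ≠ 0 := Nat.cast_add_one_ne_zero M
  have hlM : 1 + l + M ≠ 0 := poch_ne_zero_iff.1 hlk M (by omega)
  have h₁ := sum_wellPoised_lowered a b c d l hl M hb hc hd hlk
  have h₂ := sum_wellPoised_shifted a b c d l hl M hb hc hd hlk
  set t := wellPoisedTerm l (l + b - a) (l + c - a) (l + d - a)
  have h₃ : ∑ r ∈ Finset.range (M + 1 + 1), t r * (l + 2 * r) *
        baileyKernel a l r (M + 1 - r) * ((M + 1 - r) * (1 + l + M + r)) =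
      (M + 1) * (1 + l + M) * ∑ r ∈ Finset.range (M + 1 + 1),
        t r * (l + 2 * r) * baileyKernel a l r (M + 1 - r) -
      ∑ r ∈ Finset.range (M + 1 + 1),
        t r * (l + 2 * r) * baileyKernel a l r (M + 1 - r) * (r * (r + l)) := by
    rw [Finset.mul_sum, ← Finset.sum_sub_distrib]
    exact Finset.sum_congr rfl fun r _ => by ring
  simp only [mul_add (t _ * _ * _), Finset.sum_add_distrib]
  have h₄ : ∀ x : ℂ, ∑ r ∈ Finset.range (M + 1 + 1),
        t r * (l + 2 * r) * baileyKernel a l r (M + 1 - r) * (x * (r * (r + l))) =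
      x * ∑ r ∈ Finset.range (M + 1 + 1),
        t r * (l + 2 * r) * baileyKernel a l r (M + 1 - r) * (r * (r + l)) := fun x => by
    rw [Finset.mul_sum]
    exact Finset.sum_congr rfl fun r _ => by ring
  rw [h₃] at h₁
  rw [h₄, ← Finset.sum_mul]
  generalize ∑ r ∈ Finset.range (M + 1 + 1),
        t r * (l + 2 * r) *
        baileyKernel a l r (M + 1 - r) * (r * (r + l)) = S₂ at *
  generalize ∑ r ∈ Finset.range (M + 1 + 1),
        t r * (l + 2 * r) * baileyKernel a l r (M + 1 - r) = S₁ at *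
  have hbM := poch_ne_zero_iff.1 hb M M.lt_succ_self
  have hcM := poch_ne_zero_iff.1 hc M M.lt_succ_self
  have hdM := poch_ne_zero_iff.1 hd M M.lt_succ_self
  have ha : a * (a + 1) * poch (a + 2) M = poch a M * (a + M) * (a + M + 1) := by
    have := poch_add_two a M
    rw [poch_succ, poch_succ, add_comm 2 a] at this
    push_cast at this
    linear_combination -this
  have ha' : a * poch (a + 1) M = poch a M * (a + M) := by
    rw [← poch_add_one_mul]; ring
  set Z := l * (poch a M * (a + M) * (poch (1 + b) M * poch (1 + c) M * poch (1 + d) M) /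
    (M.factorial * (poch (1 + a - b) (M + 1) * poch (1 + a - c) (M + 1) *
      poch (1 + a - d) (M + 1)))) with hZ
  have h₂' : S₂ = (a - b - c) * (a - b - d) * (a - c - d) * (a + M + 1) * Z := by
    rw [h₂, hZ]
    linear_combination (l * ((a - b - c) * (a - b - d) * (a - c - d)) *
      (poch (1 + b) M * poch (1 + c) M * poch (1 + d) M) / (M.factorial *
        (poch (1 + a - b) (M + 1) * poch (1 + a - c) (M + 1) * poch (1 + a - d) (M + 1)))) * ha
  have h₁' : (M + 1) * (1 + l + M) * S₁ - S₂ =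
      (a - l) * ((1 + a - b + M) * (1 + a - c + M) * (1 + a - d + M)) * Z := by
    rw [h₁, hZ, ← ha', poch_succ, poch_succ, poch_succ]
    have h1 := poch_ne_zero_of_le hb M.le_succ
    have h2 := poch_ne_zero_of_le hc M.le_succ
    have h3 := poch_ne_zero_of_le hd M.le_succ
    field_simp
  have hR : (M + 1) * (l * ((a - b - c) * (a - b - d) * (a - c - d)) *
        (poch a (M + 1) * (poch b (M + 1) * poch c (M + 1) * poch d (M + 1)) /
          ((M + 1).factorial * (poch (1 + a - b) (M + 1) * poch (1 + a - c) (M + 1) *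
            poch (1 + a - d) (M + 1))) * (((M + 1 : ℕ) : ℂ) ^ 2 + a * (M + 1 : ℕ) + P))) =
      (a - b - c) * (a - b - d) * (a - c - d) * (b * c * d) *
        ((M + 1) ^ 2 + a * (M + 1) + P) * Z := by
    rw [hZ, poch_succ_left b, poch_succ_left c, poch_succ_left d, add_comm b, add_comm c,
      add_comm d, poch_succ a, Nat.factorial_succ]
    push_cast
    rw [mul_assoc (M + 1 : ℂ) M.factorial]
    generalize (M.factorial : ℂ) * (poch (1 + a - b) (M + 1) * poch (1 + a - c) (M + 1) *
      poch (1 + a - d) (M + 1)) = X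
    rw [mul_comm (M + 1 : ℂ) X, ← div_div]
    generalize (a - b - c) * (a - b - d) * (a - c - d) = U
    linear_combination (l * U * (poch a M * (a + M) * (b * poch (1 + b) M * (c * poch (1 + c) M) *
      (d * poch (1 + d) M)) / X) * ((M + 1) ^ 2 + a * (M + 1) + P)) * mul_inv_cancel₀ hM1
  apply mul_left_cancel₀ hM1
  rw [hR]
  apply mul_left_cancel₀ hlM
  rw [h₂'] at h₁' ⊢
  clear_value Z t
  subst hl
  linear_combination P * ((a - b - c) * (a - b - d) * (a - c - d)) * h₁'

lemma sum_baileyKernel_mul (a l q : ℂ) (r m : ℕ) (hl : poch (1 + l) (2 * r + m) ≠ 0)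
    (hl2 : l + 2 * r ≠ 0) (hla : 2 * l - a + 2 * r ≠ 0) :
    ∑ j ∈ Finset.range (m + 1),
        baileyKernel a l r j * (poch (2 * l - 2 * a) (m - j) / (m - j).factorial * (q + (r + j))) =
      poch a (2 * r) * poch (l - a) m * poch (2 * l - a + 2 * r) m /
        ((2 * l - a + 2 * r) * (m.factorial * poch (1 + l) (2 * r + m))) *
        (2 * (r * (r + l)) + q * (2 * l - a) + (r + m) * (2 * q - a)) := by
  have hl' := hl
  rw [poch_add, mul_ne_zero_iff] at hl'
  have hC : 1 + (a + 2 * r) - (a - l) = 1 + l + ((2 * r : ℕ) : ℂ) := by push_cast; ring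
  have h := sum_saalschutz_linear (a + 2 * r) (a - l) (q + r) m (by rw [hC]; exact hl'.2)
    (by rwa [show a + 2 * r - (a - l) = l + 2 * r by ring])
  rw [hC, show -2 * (a - l) = 2 * l - 2 * a by ring, show -(a - l) = l - a by ring,
    show a + 2 * r - 2 * (a - l) = 2 * l - a + 2 * r by ring] at h
  have hterm : ∀ j ∈ Finset.range (m + 1),
      baileyKernel a l r j * (poch (2 * l - 2 * a) (m - j) / (m - j).factorial * (q + (r + j))) =
      poch a (2 * r) / poch (1 + l) (2 * r) *
        (poch (a + 2 * r) j * poch (a - l) j * poch (2 * l - 2 * a) (m - j) /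
          (j.factorial * (m - j).factorial * poch (1 + l + (2 * r : ℕ)) j) * (q + r + j)) := by
    intro j _
    rw [baileyKernel, poch_add, poch_add, show a + ((2 * r : ℕ) : ℂ) = a + 2 * r by push_cast; rfl,
      add_assoc q, ← mul_assoc (_ / _) (_ / _), ← mul_assoc (_ / _) (_ / _), div_mul_div_comm,
      div_mul_div_comm]
    congr 2 <;> ring
  rw [Finset.sum_congr rfl hterm, ← Finset.mul_sum, poch_add]
  apply mul_left_cancel₀ hla
  rw [mul_left_comm, h, ← mul_assoc (_ / _) (_ / _), div_mul_div_comm,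
    ← mul_assoc (_ + _) (_ / _), ← mul_div_assoc, mul_div_mul_left _ _ hla]
  congr 2 <;> ring

/-- The Bailey-type transformation, before normalising the terms of the two series. -/
lemma sum_bailey_transform (n : ℕ) (a b c d l q P : ℂ) (hl : l = 2 * a - b - c - d)
    (hb : poch (1 + a - b) n ≠ 0) (hc : poch (1 + a - c) n ≠ 0) (hd : poch (1 + a - d) n ≠ 0)
    (hln : poch (1 + l) (2 * n) ≠ 0) (hl2 : ∀ r ≤ n, l + 2 * r ≠ 0)
    (hla : ∀ r ≤ n, 2 * l - a + 2 * r ≠ 0) :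
    l * ((a - b - c) * (a - b - d) * (a - c - d)) * ∑ k ∈ Finset.range (n + 1),
        poch a k * (poch b k * poch c k * poch d k) /
          (k.factorial * (poch (1 + a - b) k * poch (1 + a - c) k * poch (1 + a - d) k)) *
          (k ^ 2 + a * k + P) *
          (poch (2 * l - 2 * a) (n - k) / (n - k).factorial * (q + k)) =
      ∑ r ∈ Finset.range (n + 1),
        wellPoisedTerm l (l + b - a) (l + c - a) (l + d - a) r * (l + 2 * r) *
          ((b * c * d + P * (a - b - c - d)) * (r * (r + l)) +
            P * ((a - b - c) * (a - b - d) * (a - c - d))) *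
          (poch a (2 * r) * poch (l - a) (n - r) * poch (2 * l - a + 2 * r) (n - r) /
            ((2 * l - a + 2 * r) * ((n - r).factorial * poch (1 + l) (n + r))) *
            (2 * (r * (r + l)) + q * (2 * l - a) + n * (2 * q - a))) := by
  have hflip := Finset.sum_range_diag_flip (n + 1) fun r j =>
    wellPoisedTerm l (l + b - a) (l + c - a) (l + d - a) r * (l + 2 * r) *
      ((b * c * d + P * (a - b - c - d)) * (r * (r + l)) +
        P * ((a - b - c) * (a - b - d) * (a - c - d))) *
      (baileyKernel a l r j *
        (poch (2 * l - 2 * a) (n - r - j) / (n - r - j).factorial * (q + (r + j))))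
  trans ∑ m ∈ Finset.range (n + 1), ∑ r ∈ Finset.range (m + 1),
    wellPoisedTerm l (l + b - a) (l + c - a) (l + d - a) r * (l + 2 * r) *
      ((b * c * d + P * (a - b - c - d)) * (r * (r + l)) +
        P * ((a - b - c) * (a - b - d) * (a - c - d))) *
      (baileyKernel a l r (m - r) *
        (poch (2 * l - 2 * a) (n - r - (m - r)) / (n - r - (m - r)).factorial *
          (q + (r + (m - r : ℕ)))))
  · rw [Finset.mul_sum]
    refine Finset.sum_congr rfl fun k hk => ?_
    have hk := Finset.mem_range_succ_iff.1 hk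
    rw [← mul_assoc, ← sum_wellPoised_quadratic a b c d l P hl k (poch_ne_zero_of_le hb hk)
      (poch_ne_zero_of_le hc hk) (poch_ne_zero_of_le hd hk) (poch_ne_zero_of_le hln (by omega)),
      Finset.sum_mul]
    refine Finset.sum_congr rfl fun r hr => ?_
    have hr := Finset.mem_range_succ_iff.1 hr
    rw [show n - r - (k - r) = n - k by omega, Nat.cast_sub hr, add_sub_cancel]
    ring
  rw [hflip]
  refine Finset.sum_congr rfl fun r hr => ?_
  have hr := Finset.mem_range_succ_iff.1 hr
  obtain ⟨m, rfl⟩ := Nat.exists_eq_add_of_le hr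
  rw [← Finset.mul_sum, show r + m + 1 - r = m + 1 by omega, show r + m - r = m by omega,
    sum_baileyKernel_mul a l q r m (poch_ne_zero_of_le hln (by omega)) (hl2 r hr) (hla r hr),
    show r + m + r = 2 * r + m by ring]
  push_cast
  rfl

lemma poch_add_one_div {z : ℂ} {r : ℕ} (hz : z ≠ 0) (h : poch z r ≠ 0) :
    poch (z + 1) r / poch z r = (z + r) / z := by
  rw [div_eq_div_iff h hz, poch_add_one_mul, mul_comm]

lemma poch_neg_div {z w : ℂ} {n k : ℕ} (hk : k ≤ n) (hw : w = 1 - z - n) (hz : poch z n ≠ 0)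
    (hwk : poch w k ≠ 0) :
    poch (-(n : ℂ)) k / poch w k =
      n.factorial / poch z n * (poch z (n - k) / (n - k).factorial) := by
  have h1 := poch_reverse z hk
  have h2 := poch_reverse 1 hk
  rw [poch_one, poch_one, show 1 - 1 - (n : ℂ) = -n by ring] at h2
  rw [← hw] at h1
  have hf : ((n - k).factorial : ℂ) ≠ 0 := Nat.cast_ne_zero.2 (Nat.factorial_ne_zero _)
  have hs : ((-1 : ℂ) ^ k) ≠ 0 := pow_ne_zero _ (by norm_num)
  rw [div_mul_div_comm, div_eq_div_iff hwk (mul_ne_zero hz hf)]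
  apply mul_left_cancel₀ hs
  linear_combination (-1) ^ k * poch z n * h2 - (-1) ^ k * n.factorial * h1

lemma hypTerm_left_summand {n k : ℕ} (hk : k ≤ n) {a b c d p q h w : ℂ} (hw : w = 1 - h - n)
    (hp : p ≠ 0) (hap : a - p ≠ 0) (hq : q ≠ 0) (hpk : poch p k ≠ 0) (hapk : poch (a - p) k ≠ 0)
    (hqk : poch q k ≠ 0) (hwk : poch w k ≠ 0) (hh : poch h n ≠ 0) :
    poch a k * (poch b k * (poch c k * (poch d k *
      (poch (a - p + 1) k * (poch (p + 1) k * poch (q + 1) k))))) * poch (-(n : ℂ)) k /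
      (k.factorial * (poch (1 + a - b) k * (poch (1 + a - c) k * (poch (1 + a - d) k *
        (poch p k * (poch (a - p) k * (poch q k * poch w k))))))) =
    n.factorial / (p * (a - p) * q * poch h n) *
      (poch a k * (poch b k * poch c k * poch d k) /
        (k.factorial * (poch (1 + a - b) k * poch (1 + a - c) k * poch (1 + a - d) k)) *
        (k ^ 2 + a * k + p * (a - p)) *
        (poch h (n - k) / (n - k).factorial * (q + k))) := by
  trans poch a k * (poch b k * poch c k * poch d k) /
      (k.factorial * (poch (1 + a - b) k * poch (1 + a - c) k * poch (1 + a - d) k)) *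
      (poch (a - p + 1) k / poch (a - p) k) * (poch (p + 1) k / poch p k) *
      (poch (q + 1) k / poch q k) * (poch (-(n : ℂ)) k / poch w k)
  · simp only [div_mul_div_comm]
    congr 1 <;> ring
  rw [poch_add_one_div hp hpk, poch_add_one_div hap hapk, poch_add_one_div hq hqk,
    poch_neg_div hk hw hh hwk]
  simp only [div_mul_eq_mul_div, mul_div_assoc', div_div]
  congr 1 <;> ring

lemma poch_symm_ratio {x g : ℂ} {r : ℕ} (h₁ : x + g ≠ 0) (h₂ : x - g ≠ 0)
    (h₁r : poch (x + g) r ≠ 0) (h₂r : poch (x - g) r ≠ 0) :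
    poch (x - g + 1) r * poch (x + g + 1) r / (poch (x + g) r * poch (x - g) r) =
      (r * (r + 2 * x) + (x ^ 2 - g ^ 2)) / (x ^ 2 - g ^ 2) := by
  rw [mul_comm (poch (x + g) r), ← div_mul_div_comm, poch_add_one_div h₁ h₁r,
    poch_add_one_div h₂ h₂r, div_mul_div_comm]
  congr 1 <;> ring

lemma poch_half_ratio (x y : ℂ) (r : ℕ) :
    poch (x / 2) r * poch ((x + 1) / 2) r / (poch (y / 2) r * poch ((y + 1) / 2) r) =
      poch x (2 * r) / poch y (2 * r) := by
  rw [poch_two_mul, poch_two_mul, mul_div_mul_left _ _ (pow_ne_zero r (by norm_num))]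

lemma hypTerm_right_summand {n r : ℕ} (hr : r ≤ n) {a b c d l w γ δ : ℂ}
    (hw : w = 1 + 2 * a - 2 * l - n) (hl0 : l / 2 ≠ 0)
    (hlr : poch (l / 2) r ≠ 0) (hwr : poch (l + w - a) r ≠ 0) (hla : poch (l - a) n ≠ 0)
    (hγ : l / 2 + γ ≠ 0) (hγ' : l / 2 - γ ≠ 0)
    (hγr : poch (l / 2 + γ) r ≠ 0) (hγr' : poch (l / 2 - γ) r ≠ 0)
    (hδ : l / 2 + δ ≠ 0) (hδ' : l / 2 - δ ≠ 0)
    (hδr : poch (l / 2 + δ) r ≠ 0) (hδr' : poch (l / 2 - δ) r ≠ 0) :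
    poch l r * (poch (1 + l / 2) r * (poch (a / 2) r * (poch ((a + 1) / 2) r *
      (poch (l + b - a) r * (poch (l + c - a) r * (poch (l + d - a) r * (poch (1 + a - w) r *
      (poch (l / 2 - γ + 1) r * (poch (l / 2 + γ + 1) r * (poch (l / 2 - δ + 1) r *
        poch (l / 2 + δ + 1) r)))))))))) * poch (-(n : ℂ)) r /
      (r.factorial * (poch (l / 2) r * (poch ((2 + 2 * l - a) / 2) r *
        (poch ((1 + 2 * l - a) / 2) r * (poch (1 + a - b) r * (poch (1 + a - c) r *
        (poch (1 + a - d) r * (poch (l + w - a) r * (poch (l / 2 + γ) r * (poch (l / 2 - γ) r *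
        (poch (l / 2 + δ) r * (poch (l / 2 - δ) r * poch (1 + l + (n : ℂ)) r)))))))))))) =
    n.factorial / (l * (l ^ 2 / 4 - γ ^ 2) * (l ^ 2 / 4 - δ ^ 2) * poch (l - a) n) *
      (wellPoisedTerm l (l + b - a) (l + c - a) (l + d - a) r * (l + 2 * r) *
        (r * (r + l) + (l ^ 2 / 4 - γ ^ 2)) * (r * (r + l) + (l ^ 2 / 4 - δ ^ 2)) *
        (poch a (2 * r) * poch (l - a) (n - r) * poch (2 * l - a + n) r /
          (poch (1 + 2 * l - a) (2 * r) * (n - r).factorial * poch (1 + l + (n : ℂ)) r))) := by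
  trans wellPoisedTerm l (l + b - a) (l + c - a) (l + d - a) r *
      (poch (l / 2 + 1) r / poch (l / 2) r) *
      (poch (a / 2) r * poch ((a + 1) / 2) r /
        (poch ((1 + 2 * l - a) / 2) r * poch ((1 + 2 * l - a + 1) / 2) r)) *
      (poch (2 * l - a + n) r / poch (1 + l + (n : ℂ)) r) *
      (poch (-(n : ℂ)) r / poch (l + w - a) r) *
      (poch (l / 2 - γ + 1) r * poch (l / 2 + γ + 1) r /
        (poch (l / 2 + γ) r * poch (l / 2 - γ) r)) *
      (poch (l / 2 - δ + 1) r * poch (l / 2 + δ + 1) r /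
        (poch (l / 2 + δ) r * poch (l / 2 - δ) r))
  · rw [wellPoisedTerm, show 1 + l - (l + b - a) = 1 + a - b by ring,
      show 1 + l - (l + c - a) = 1 + a - c by ring, show 1 + l - (l + d - a) = 1 + a - d by ring,
      show 1 + a - w = 2 * l - a + n by rw [hw]; ring, add_comm 1 (l / 2),
      show 1 + 2 * l - a + 1 = 2 + 2 * l - a by ring]
    simp only [div_mul_div_comm]
    congr 1 <;> ring
  rw [poch_add_one_div hl0 hlr, poch_half_ratio, poch_neg_div hr (z := l - a) (by rw [hw]; ring)
    hla hwr, poch_symm_ratio hγ hγ' hγr hγr', poch_symm_ratio hδ hδ' hδr hδr',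
    show (l / 2 + r) / (l / 2) = (l + 2 * r) / l by
      rw [← mul_div_mul_left _ _ (two_ne_zero (α := ℂ))]; congr 1 <;> ring,
    show 2 * (l / 2) = l by ring, show (l / 2) ^ 2 = l ^ 2 / 4 by ring]
  generalize l ^ 2 / 4 - γ ^ 2 = G
  generalize l ^ 2 / 4 - δ ^ 2 = H
  simp only [div_mul_eq_mul_div, mul_div_assoc', div_div]
  congr 1 <;> ring

lemma poch_div_shift {x : ℂ} {n r : ℕ} (hr : r ≤ n) (hx : x ≠ 0) (hxr : x + 2 * r ≠ 0)
    (hx1 : poch (1 + x) (2 * r) ≠ 0) :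
    poch (x + 2 * r) (n - r) / (x + 2 * r) =
      poch x n * poch (x + n) r / (x * poch (1 + x) (2 * r)) := by
  have h := poch_add x (2 * r) (n - r)
  rw [show 2 * r + (n - r) = n + r by omega, poch_add x n r] at h
  have h' := poch_add_one_mul x (2 * r)
  rw [add_comm x 1] at h'
  push_cast at h h'
  rw [div_eq_div_iff hxr (mul_ne_zero hx hx1)]
  linear_combination poch (x + 2 * r) (n - r) * h' - (x + 2 * r) * h

lemma bailey_term_match {F P q h l U W m D S A L' V E f O T x G K L xn xr Y o or : ℂ}
    (hP : P ≠ 0) (hU : U ≠ 0) (hG : G ≠ 0) (hK : K ≠ 0) (hL : L ≠ 0) (hDG : D * G = P * U)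
    (hV : V / E = xn * xr / (x * Y)) (hO : O = o * or) :
    F / (P * q * h) * (W * m * (D * S) * (A * L' * V / (E * (f * O)) * (2 * T)) / (l * U)) =
      xn * L / (o * h) * (2 * K / (q * x)) *
        (F / (l * G * K * L) * (W * m * S * T * (A * L' * xr / (Y * f * or)))) := by
  obtain rfl : D = P * U / G := by rw [eq_div_iff hG, hDG]
  subst hO
  have e : P * P⁻¹ * (U * U⁻¹) = K * K⁻¹ * (L * L⁻¹) := by
    rw [mul_inv_cancel₀ hP, mul_inv_cancel₀ hU, mul_inv_cancel₀ hK, mul_inv_cancel₀ hL]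
  rw [div_eq_mul_inv, div_eq_mul_inv, mul_inv] at hV
  simp only [div_eq_mul_inv, mul_inv]
  linear_combination (2 * F * q⁻¹ * h⁻¹ * W * m * G⁻¹ * S * A * L' * f⁻¹ * o⁻¹ * or⁻¹ * T * l⁻¹) *
    (P * P⁻¹ * (U * U⁻¹) * hV + xn * xr * x⁻¹ * Y⁻¹ * e)

theorem proposition_13P4 (n : ℕ) (a b c d p q : ℂ)
    (lm w : ℂ) (hlm : lm = 2 * a - b - c - d) (hw : w = 1 + 2 * a - 2 * lm - (n : ℂ))
    (h2q : 2 * q - a ≠ 0)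
    (hbcd : b * c * d + p * (a - p) * (a - b - c - d) ≠ 0)
    (α γ δ : ℂ)
    (hα : α = q * (2 * lm - a) / (2 * q - a))
    (hγ : γ ^ 2 = lm ^ 2 / 4 -
      p * (a - p) * (a - b - c) * (a - b - d) * (a - c - d) /
        (b * c * d + p * (a - p) * (a - b - c - d)))
    (hδ : δ ^ 2 = lm ^ 2 / 4 - (q * (2 * lm - a) + (n : ℂ) * (2 * q - a)) / 2)
    (hnd : ∀ z ∈ [1 + a - b, 1 + a - c, 1 + a - d, p, a - p, q, w,
        lm / 2, (2 + 2 * lm - a) / 2, (1 + 2 * lm - a) / 2, lm + w - a,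
        lm / 2 + γ, lm / 2 - γ, lm / 2 + δ, lm / 2 - δ, 1 + lm + (n : ℂ),
        1 + lm, 2 * lm - 2 * a, α],
      ∀ k ≤ n, poch z k ≠ 0) :
    hypTerm [a, b, c, d, a - p + 1, p + 1, q + 1]
        [1 + a - b, 1 + a - c, 1 + a - d, p, a - p, q, w] n 1
      = poch (2 * lm - a) n * poch (lm - a) n * poch (α + 1) n /
          (poch (1 + lm) n * poch (2 * lm - 2 * a) n * poch α n) *
        hypTerm [lm, 1 + lm / 2, a / 2, (a + 1) / 2, lm + b - a, lm + c - a, lm + d - a,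
            1 + a - w, lm / 2 - γ + 1, lm / 2 + γ + 1, lm / 2 - δ + 1, lm / 2 + δ + 1]
          [lm / 2, (2 + 2 * lm - a) / 2, (1 + 2 * lm - a) / 2, 1 + a - b, 1 + a - c,
            1 + a - d, lm + w - a, lm / 2 + γ, lm / 2 - γ, lm / 2 + δ, lm / 2 - δ,
            1 + lm + (n : ℂ)] n 1 := by
  have hnd' : ∀ z ∈ [1 + a - b, 1 + a - c, 1 + a - d, p, a - p, q, w,
      lm / 2, (2 + 2 * lm - a) / 2, (1 + 2 * lm - a) / 2, lm + w - a,
      lm / 2 + γ, lm / 2 - γ, lm / 2 + δ, lm / 2 - δ, 1 + lm + (n : ℂ),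
      1 + lm, 2 * lm - 2 * a, α], poch z n ≠ 0 := fun z hz => hnd z hz n le_rfl
  clear hnd
  simp only [List.forall_mem_cons, List.not_mem_nil, IsEmpty.forall_iff, implies_true,
    and_true] at hnd'
  obtain ⟨hb, hc, hd, hp, hap, hq, hwn, hl2, hx2, hx1, hlw, hγ1, hγ2, hδ1, hδ2, hln, hl1, hh,
    hαn⟩ := hnd'
  rcases Nat.eq_zero_or_pos n with rfl | hn
  · simp [hypTerm, poch_zero]
  have hne : ∀ {z : ℂ}, poch z n ≠ 0 → z ≠ 0 := fun {z} h => by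
    simpa using poch_ne_zero_iff.1 h 0 hn
  have hp0 := hne hp
  have hap0 := hne hap
  have hq0 := hne hq
  have hl20 := hne hl2
  have hl0 : lm ≠ 0 := fun h => hl20 (by rw [h, zero_div])
  have hα0 := hne hαn
  have hx0 : 2 * lm - a ≠ 0 := fun h => hα0 (by rw [hα, h, mul_zero, zero_div])
  have hG : lm ^ 2 / 4 - γ ^ 2 ≠ 0 := by
    rw [show lm ^ 2 / 4 - γ ^ 2 = (lm / 2 + γ) * (lm / 2 - γ) by ring]
    exact mul_ne_zero (hne hγ1) (hne hγ2)
  have hΔ : lm ^ 2 / 4 - δ ^ 2 ≠ 0 := by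
    rw [show lm ^ 2 / 4 - δ ^ 2 = (lm / 2 + δ) * (lm / 2 - δ) by ring]
    exact mul_ne_zero (hne hδ1) (hne hδ2)
  have hDG : (b * c * d + p * (a - p) * (a - b - c - d)) * (lm ^ 2 / 4 - γ ^ 2) =
      p * (a - p) * ((a - b - c) * (a - b - d) * (a - c - d)) := by
    rw [hγ, sub_sub_cancel, mul_div_cancel₀ _ hbcd]
    ring
  have hU : (a - b - c) * (a - b - d) * (a - c - d) ≠ 0 :=
    right_ne_zero_of_mul (hDG ▸ mul_ne_zero hbcd hG)
  have hαr : poch (α + 1) n / poch α n = 2 * (lm ^ 2 / 4 - δ ^ 2) / (q * (2 * lm - a)) := by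
    rw [poch_add_one_div hα0 hαn, div_eq_div_iff hα0 (mul_ne_zero hq0 hx0), hδ]
    linear_combination -n * (eq_div_iff h2q).1 hα
  have hl2n : poch (1 + lm) (2 * n) ≠ 0 := by
    rw [two_mul, poch_add]
    exact mul_ne_zero hl1 hln
  have hx2n : poch (1 + 2 * lm - a) (2 * n) ≠ 0 := by
    rw [poch_two_mul, show 1 + 2 * lm - a + 1 = 2 + 2 * lm - a by ring]
    exact mul_ne_zero (pow_ne_zero n (by norm_num)) (mul_ne_zero hx1 hx2)
  have hshift : ∀ {z : ℂ}, z ≠ 0 → poch (1 + z) (2 * n) ≠ 0 → ∀ r ≤ n, z + 2 * r ≠ 0 := by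
    intro z hz h r hr
    have h' : poch z (2 * n + 1) ≠ 0 := by
      rw [poch_succ_left, add_comm z]
      exact mul_ne_zero hz h
    exact_mod_cast poch_ne_zero_iff.1 h' (2 * r) (by omega)
  have hla : poch (lm - a) n ≠ 0 := by
    intro h
    have h' := poch_reverse (lm - a) (le_refl n)
    rw [h, mul_zero, Nat.sub_self, poch_zero, mul_one,
      show 1 - (lm - a) - n = lm + w - a by rw [hw]; ring] at h'
    exact hlw h'
  rw [add_sub_assoc] at hx2n
  have hxr := hshift hx0 hx2n
  have hT := sum_bailey_transform n a b c d lm q (p * (a - p)) hlm hb hc hd hl2n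
    (hshift hl0 hl2n) hxr
  have hT' := eq_div_of_mul_eq (mul_ne_zero hl0 hU) ((mul_comm _ _).trans hT)
  simp only [hypTerm, List.map_cons, List.map_nil, List.prod_cons, List.prod_nil, mul_one,
    one_pow]
  trans n.factorial / (p * (a - p) * q * poch (2 * lm - 2 * a) n) *
    ∑ k ∈ Finset.range (n + 1),
        poch a k * (poch b k * poch c k * poch d k) /
          (k.factorial * (poch (1 + a - b) k * poch (1 + a - c) k * poch (1 + a - d) k)) *
          (k ^ 2 + a * k + p * (a - p)) *
          (poch (2 * lm - 2 * a) (n - k) / (n - k).factorial * (q + k))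
  · rw [Finset.mul_sum]
    refine Finset.sum_congr rfl fun k hk => ?_
    have hk := Finset.mem_range_succ_iff.1 hk
    exact hypTerm_left_summand hk (by rw [hw]; ring) hp0 hap0 hq0 (poch_ne_zero_of_le hp hk)
      (poch_ne_zero_of_le hap hk) (poch_ne_zero_of_le hq hk) (poch_ne_zero_of_le hwn hk) hh
  rw [hT', Finset.sum_div, Finset.mul_sum, Finset.mul_sum, ← div_mul_div_comm, hαr]
  refine Finset.sum_congr rfl fun r hr => ?_
  have hr := Finset.mem_range_succ_iff.1 hr
  rw [hypTerm_right_summand hr hw hl20 (poch_ne_zero_of_le hl2 hr) (poch_ne_zero_of_le hlw hr) hla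
    (hne hγ1) (hne hγ2) (poch_ne_zero_of_le hγ1 hr) (poch_ne_zero_of_le hγ2 hr)
    (hne hδ1) (hne hδ2) (poch_ne_zero_of_le hδ1 hr) (poch_ne_zero_of_le hδ2 hr)]
  have hV := poch_div_shift hr hx0 (hxr r hr) (poch_ne_zero_of_le hx2n (by omega))
  have hquad : 2 * (r * (r + lm)) + q * (2 * lm - a) + n * (2 * q - a) =
      2 * (r * (r + lm) + (lm ^ 2 / 4 - δ ^ 2)) := by
    rw [hδ]
    ring
  rw [hquad, ← hDG, ← mul_add, add_sub_assoc 1 (2 * lm) a]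
  exact bailey_term_match (mul_ne_zero hp0 hap0) hU hG hΔ hla hDG hV (poch_add _ _ _)
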